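/- Let 1 ≤ p < q < ∞ and d ≥ 1. Define f(x) := |x|^{−d/q}, g(x) := χ_{(0,1)}(|x|) f(x), and k(x) := −f(x) + 2g(x) for x ∈ ℝ^d. Then min{‖f+k‖_{M^p_q}, ‖f−k‖_{M^p_q}} = 2‖f‖_{M^p_q} = 2‖k‖_{M^p_q}. -/

import Mathlib

open MeasureTheory
open scoped ENNReal

/-- The Morrey norm `‖f‖_{M^p_q}` of a (measurable) function on `ℝ^d`:
the supremum over all balls `B = B(a,r)` of `|B|^(1/q - 1/p) (∫_B |f|^p)^(1/p)`. -/
noncomputable def morreyNorm (p q : ℝ) (d : ℕ) (f : EuclideanSpace ℝ (Fin d) → ℝ) : ℝ≥0∞ :=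
  ⨆ (a : EuclideanSpace ℝ (Fin d)) (r : ℝ) (_ : 0 < r),
    volume (Metric.ball a r) ^ ((1:ℝ)/q - 1/p) *
      (∫⁻ y in Metric.ball a r, ENNReal.ofReal (|f y| ^ p)) ^ ((1:ℝ)/p)

open Filter Topology
open scoped Pointwise

theorem morreyNorm_const_smul {p : ℝ} (hp : 0 < p) (q : ℝ) {d : ℕ} (c : ℝ)
    (u : EuclideanSpace ℝ (Fin d) → ℝ) :
    morreyNorm p q d (c • u) = ENNReal.ofReal |c| * morreyNorm p q d u := by
  have key : ∀ y, ENNReal.ofReal (|(c • u) y| ^ p) =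
      ENNReal.ofReal |c| ^ p * ENNReal.ofReal (|u y| ^ p) := fun y => by
    rw [Pi.smul_apply, smul_eq_mul, abs_mul, Real.mul_rpow (abs_nonneg _) (abs_nonneg _),
      ENNReal.ofReal_mul (by positivity), ENNReal.ofReal_rpow_of_nonneg (abs_nonneg _) hp.le]
  unfold morreyNorm
  simp_rw [ENNReal.mul_iSup, key]
  refine iSup_congr fun a => iSup_congr fun r => iSup_congr fun _ => ?_
  rw [lintegral_const_mul' _ _ (ENNReal.rpow_ne_top_of_nonneg hp.le ENNReal.ofReal_ne_top),
    ENNReal.mul_rpow_of_nonneg _ _ (by positivity), ← ENNReal.rpow_mul, mul_one_div_cancel hp.ne',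
    ENNReal.rpow_one, mul_left_comm]

theorem morreyNorm_mono {p : ℝ} (hp : 0 ≤ p) (q : ℝ) {d : ℕ}
    {u v : EuclideanSpace ℝ (Fin d) → ℝ} (h : ∀ x, |u x| ≤ |v x|) :
    morreyNorm p q d u ≤ morreyNorm p q d v := by
  refine iSup_mono fun a => iSup_mono fun r => iSup_mono fun _ => ?_
  gcongr _ * (∫⁻ _ in _, ENNReal.ofReal (?_ ^ p)) ^ _ with y
  exact h y

theorem morreyNorm_comp_smul_le {p : ℝ} (hp : 0 < p) {q : ℝ} {d : ℕ}
    {u : EuclideanSpace ℝ (Fin d) → ℝ} (hu : Measurable u) {t : ℝ} (ht : 0 < t) :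
    ENNReal.ofReal (t ^ ((d : ℝ) / q)) * morreyNorm p q d (fun x => u (t • x)) ≤
      morreyNorm p q d u := by
  unfold morreyNorm
  simp_rw [ENNReal.mul_iSup]
  refine iSup_le fun a => iSup_le fun r => iSup_le fun hr => ?_
  refine le_trans (le_of_eq ?_)
    (le_iSup_of_le (t • a) (le_iSup_of_le (t * r) (le_iSup_of_le (mul_pos ht hr) le_rfl)))
  set T : ℝ≥0∞ := ENNReal.ofReal (t ^ d) with hT
  have hT0 : T ≠ 0 := by simp [hT, ht]
  have hTt : T ≠ ∞ := ENNReal.ofReal_ne_top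
  have hball : Metric.ball (t • a) (t * r) = t • Metric.ball a r := by
    rw [smul_ball ht.ne', Real.norm_of_nonneg ht.le]
  have hvol : volume (Metric.ball (t • a) (t * r)) = T * volume (Metric.ball a r) := by
    rw [hball, Measure.addHaar_smul, finrank_euclideanSpace_fin, abs_of_pos (by positivity)]
  have hpre : (fun x => t • x) ⁻¹' Metric.ball (t • a) (t * r) = Metric.ball a r := by
    rw [hball, Set.preimage_smul₀ ht.ne', inv_smul_smul₀ ht.ne']
  have hint : ∫⁻ y in Metric.ball (t • a) (t * r), ENNReal.ofReal (|u y| ^ p) =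
      T * ∫⁻ y in Metric.ball a r, ENNReal.ofReal (|u (t • y)| ^ p) := by
    have h := setLIntegral_map (μ := (volume : Measure (EuclideanSpace ℝ (Fin d))))
      (f := fun y => ENNReal.ofReal (|u y| ^ p)) (g := fun x => t • x)
      (s := Metric.ball (t • a) (t * r)) measurableSet_ball (by fun_prop) (by fun_prop)
    rw [hpre, Measure.map_addHaar_smul _ ht.ne', finrank_euclideanSpace_fin,
      abs_of_pos (by positivity), ENNReal.ofReal_inv_of_pos (by positivity), ← hT,
      Measure.restrict_smul, lintegral_smul_measure, smul_eq_mul] at h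
    rw [← h, ← mul_assoc, ENNReal.mul_inv_cancel hT0 hTt, one_mul]
  have hTq : ENNReal.ofReal (t ^ ((d : ℝ) / q)) = T ^ ((1:ℝ)/q - 1/p) * T ^ ((1:ℝ)/p) := by
    rw [← ENNReal.rpow_add _ _ hT0 hTt, sub_add_cancel, hT,
      ENNReal.ofReal_rpow_of_pos (by positivity), ← Real.rpow_natCast, ← Real.rpow_mul ht.le,
      mul_one_div]
  rw [hvol, hint, hTq, ENNReal.mul_rpow_of_ne_top hTt measure_ball_lt_top.ne,
    ENNReal.mul_rpow_of_nonneg _ _ (by positivity)]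
  ring

/-- Fatou property of the Morrey norm. -/
theorem morreyNorm_le_of_tendsto {p : ℝ} (hp : 0 < p) (q : ℝ) {d : ℕ}
    {u : ℕ → EuclideanSpace ℝ (Fin d) → ℝ} {v : EuclideanSpace ℝ (Fin d) → ℝ} {C : ℝ≥0∞}
    (hu : ∀ n, Measurable (u n)) (huv : ∀ x, Tendsto (fun n => u n x) atTop (𝓝 (v x)))
    (hC : ∀ n, morreyNorm p q d (u n) ≤ C) : morreyNorm p q d v ≤ C := by
  refine iSup_le fun a => iSup_le fun r => iSup_le fun hr => ?_
  set W : ℝ≥0∞ := volume (Metric.ball a r) ^ ((1:ℝ)/q - 1/p)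
  have hV0 : volume (Metric.ball a r) ≠ 0 := (Metric.measure_ball_pos _ _ hr).ne'
  have hVt : volume (Metric.ball a r) ≠ ∞ := measure_ball_lt_top.ne
  have hW0 : W ≠ 0 := (ENNReal.rpow_pos (pos_iff_ne_zero.2 hV0) hVt).ne'
  have hWt : W ≠ ∞ := ENNReal.rpow_ne_top_of_ne_zero hV0 hVt
  have hbound : ∀ I : ℝ≥0∞, W * I ^ ((1:ℝ)/p) ≤ C ↔ I ≤ (C / W) ^ p := fun I => by
    rw [mul_comm, ← ENNReal.le_div_iff_mul_le (Or.inl hW0) (Or.inl hWt), one_div,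
      ENNReal.rpow_inv_le_iff hp]
  rw [hbound]
  have hlim : ∀ y, ENNReal.ofReal (|v y| ^ p) =
      liminf (fun n => ENNReal.ofReal (|u n y| ^ p)) atTop := fun y =>
    (ENNReal.tendsto_ofReal ((huv y).abs.rpow_const (Or.inr hp.le))).liminf_eq.symm
  simp_rw [hlim]
  refine (lintegral_liminf_le fun n => by have := hu n; fun_prop).trans ?_
  refine liminf_le_of_le (by isBoundedDefault) fun b hb => ?_
  obtain ⟨n, hn⟩ := hb.exists
  refine hn.trans ((hbound _).1 (le_trans ?_ (hC n)))
  exact le_iSup_of_le a (le_iSup_of_le r (le_iSup_of_le hr le_rfl))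

theorem morreyNorm_le_of_tendsto_dilation {p : ℝ} (hp : 0 < p) {q : ℝ} {d : ℕ}
    {u v : EuclideanSpace ℝ (Fin d) → ℝ} (hu : Measurable u) {t : ℕ → ℝ} (ht : ∀ n, 0 < t n)
    (huv : ∀ x, Tendsto (fun n => t n ^ ((d : ℝ) / q) * u (t n • x)) atTop (𝓝 (v x))) :
    morreyNorm p q d v ≤ morreyNorm p q d u := by
  refine morreyNorm_le_of_tendsto hp q
    (u := fun n => (t n ^ ((d : ℝ) / q)) • fun x => u (t n • x)) (fun n => ?_) huv fun n => ?_
  · exact (hu.comp (measurable_const_smul (t n))).const_smul _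
  · rw [morreyNorm_const_smul hp, abs_of_pos (Real.rpow_pos_of_pos (ht n) _)]
    exact morreyNorm_comp_smul_le hp hu (ht n)

theorem rpow_mul_norm_smul_rpow {d : ℕ} (q : ℝ) {t : ℝ} (ht : 0 < t)
    (x : EuclideanSpace ℝ (Fin d)) :
    t ^ ((d : ℝ) / q) * ‖t • x‖ ^ (-(d : ℝ) / q) = ‖x‖ ^ (-(d : ℝ) / q) := by
  rw [norm_smul, Real.norm_of_nonneg ht.le, Real.mul_rpow ht.le (norm_nonneg _), ← mul_assoc,
    ← Real.rpow_add ht, neg_div, add_neg_cancel, Real.rpow_zero, one_mul]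

/-- For `1 ≤ p < q < ∞`, `d ≥ 1`, `f(x) = |x|^(-d/q)`, `g = χ_(0,1)(|x|) f`,
`k = -f + 2g`, one has `min(‖f+k‖, ‖f-k‖) = 2‖f‖ = 2‖k‖` in Morrey norm. -/
theorem morreyNorm_min_eq (p q : ℝ) (d : ℕ) (hp : 1 ≤ p) (hpq : p < q) (hd : 1 ≤ d)
    (f g k : EuclideanSpace ℝ (Fin d) → ℝ)
    (hf : f = fun x => ‖x‖ ^ (-(d : ℝ) / q))
    (hg : g = fun x => if 0 < ‖x‖ ∧ ‖x‖ < 1 then f x else 0)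
    (hk : k = -f + (2 : ℝ) • g) :
    min (morreyNorm p q d (f + k)) (morreyNorm p q d (f - k)) = 2 * morreyNorm p q d f ∧
    2 * morreyNorm p q d f = 2 * morreyNorm p q d k := by
  have hp0 : 0 < p := by linarith
  have hq0 : 0 < q := by linarith
  have hd0 : (0 : ℝ) < d := by exact_mod_cast hd
  have hf0 : f 0 = 0 := by
    rw [hf]
    simp only [norm_zero]
    exact Real.zero_rpow (div_neg_of_neg_of_pos (neg_neg_of_pos hd0) hq0).ne
  have hfm : Measurable f := by rw [hf]; fun_prop
  have hg' : ∀ x, g x = if ‖x‖ < 1 then f x else 0 := fun x => by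
    rcases eq_or_ne x 0 with rfl | hx
    · simp [hg, hf0]
    · simp [hg, hx]
  have hgm : Measurable g := by
    rw [funext hg']
    exact Measurable.ite (measurableSet_lt (by fun_prop) (by fun_prop)) hfm measurable_const
  have hfs : ∀ t : ℝ, 0 < t → ∀ x, t ^ ((d : ℝ) / q) * f (t • x) = f x := fun t ht x => by
    rw [hf]; exact rpow_mul_norm_smul_rpow q ht x
  have hkx : ∀ x, k x = if ‖x‖ < 1 then f x else -f x := fun x => by
    simp only [hk, Pi.add_apply, Pi.neg_apply, Pi.smul_apply, smul_eq_mul, hg']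
    split_ifs <;> ring
  have hkf : morreyNorm p q d k = morreyNorm p q d f := by
    have : ∀ x, |k x| = |f x| := fun x => by
      rw [hkx]; split_ifs
      · rfl
      · exact abs_neg _
    exact le_antisymm (morreyNorm_mono hp0.le q fun x => (this x).le)
      (morreyNorm_mono hp0.le q fun x => (this x).ge)
  have htwo : ∀ u : EuclideanSpace ℝ (Fin d) → ℝ,
      morreyNorm p q d ((2 : ℝ) • u) = 2 * morreyNorm p q d u := fun u => by
    rw [morreyNorm_const_smul hp0]; simp
  have hadd : f + k = (2 : ℝ) • g := by rw [hk]; abel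
  have hsub : f - k = (2 : ℝ) • (f - g) := by rw [hk, smul_sub, two_smul ℝ f]; abel
  have hnorm : ∀ {t : ℝ}, 0 < t → ∀ x : EuclideanSpace ℝ (Fin d), ‖t • x‖ = t * ‖x‖ :=
    fun ht x => by rw [norm_smul, Real.norm_of_nonneg ht.le]
  have hgn : morreyNorm p q d g = morreyNorm p q d f := by
    refine le_antisymm (morreyNorm_mono hp0.le q fun x => ?_)
      (morreyNorm_le_of_tendsto_dilation hp0 hgm (t := fun n => ((n : ℝ) + 1)⁻¹)
        (fun n => by positivity) fun x => ?_)
    · rw [hg']; split_ifs <;> simp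
    · refine tendsto_const_nhds.congr' ?_
      filter_upwards [tendsto_natCast_atTop_atTop.eventually_ge_atTop ‖x‖] with n hn
      have hn0 : (0 : ℝ) < (n : ℝ) + 1 := by positivity
      rw [hg', if_pos, hfs _ (inv_pos.2 hn0)]
      rw [hnorm (inv_pos.2 hn0), inv_mul_lt_one₀ hn0]
      linarith
  have hfgn : morreyNorm p q d (f - g) = morreyNorm p q d f := by
    refine le_antisymm (morreyNorm_mono hp0.le q fun x => ?_)
      (morreyNorm_le_of_tendsto_dilation hp0 (hfm.sub hgm) (t := fun n => (n : ℝ) + 1)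
        (fun n => by positivity) fun x => ?_)
    · rw [Pi.sub_apply, hg']; split_ifs <;> simp
    · refine tendsto_const_nhds.congr' ?_
      rcases eq_or_ne x 0 with rfl | hx
      · simp [hg', hf0]
      filter_upwards [tendsto_natCast_atTop_atTop.eventually_ge_atTop ‖x‖⁻¹] with n hn
      have hn0 : (0 : ℝ) < (n : ℝ) + 1 := by positivity
      rw [Pi.sub_apply, hg', if_neg, sub_zero, hfs _ hn0]
      rw [hnorm hn0, not_lt, ← inv_le_iff_one_le_mul₀ (norm_pos_iff.2 hx)]
      linarith
  rw [hadd, hsub, htwo, htwo, hgn, hfgn, hkf, min_self]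
  exact ⟨rfl, rfl⟩
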